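/- Fix γ̄ > 0, ε̄ > 0, γ_th > 0 and ε ∈ (ε̄, (3/2)ε̄); set k = √(ε̄/(3ε̄ − 2ε)) − 1 (so k > 0) and assume k ≠ 1, and let ν = γ̄ k/(2ε̄). Let γ₁, γ₂ be i.i.d. with density (2/γ̄)e^{−2x/γ̄}, ε₁, ε₂ i.i.d. exponential with mean ε̄, all independent, and s = 1 if γ₁ − γ₂ > ν(ε₂ − ε₁), s = 2 otherwise. Then E[ε_s] = ε and the outage probability equals P(γ_s < γ_th) = [ e^{−4γ_th/γ̄} (e^{2γ_th/γ̄} − 1)² + k² ( e^{−2γ_th/γ̄} (2 − e^{−2γ_th/(γ̄ k)}) − 1 ) ] / (1 − k²). (Proposition 2: the outage probability of the weighted difference scheme for a given average energy transfer ε.) -/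

import Mathlib

open MeasureTheory ProbabilityTheory Real

/-- The joint law of `(γ₁, γ₂, ε₁, ε₂)`: `γ₁, γ₂` are i.i.d. with density
`(2/γ̄)e^{-2x/γ̄}` on `(0,∞)` (exponential with rate `2/γ̄`), `ε₁, ε₂` are i.i.d.
exponential with mean `ε̄` (rate `1/ε̄`), and all four are mutually independent.
A sample point `ω` has `ω.1 = γ₁`, `ω.2.1 = γ₂`, `ω.2.2.1 = ε₁`, `ω.2.2.2 = ε₂`. -/
noncomputable def wdMeasure (γbar εbar : ℝ) : Measure (ℝ × ℝ × ℝ × ℝ) :=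
  (expMeasure (2 / γbar)).prod
    ((expMeasure (2 / γbar)).prod ((expMeasure (1 / εbar)).prod (expMeasure (1 / εbar))))

open Set

/-- The law of the difference of two independent exponential variables of rate `r`. -/
noncomputable def laplaceMeasure (r : ℝ) : Measure ℝ :=
  volume.withDensity fun u ↦ ENNReal.ofReal (r / 2 * exp (-(r * |u|)))

/-- The survival function of `laplaceMeasure r`. -/
noncomputable def laplaceTail (r c : ℝ) : ℝ :=
  if 0 ≤ c then exp (-(r * c)) / 2 else 1 - exp (r * c) / 2

lemma expMeasure_eq_withDensity (r : ℝ) :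
    expMeasure r = volume.withDensity (exponentialPDF r) := rfl

lemma measurable_exponentialPDF (r : ℝ) : Measurable (exponentialPDF r) :=
  (measurable_exponentialPDFReal r).ennreal_ofReal

lemma lintegral_exponentialPDF_mul_shift {r : ℝ} (hr : 0 < r) (u : ℝ) :
    ∫⁻ y, exponentialPDF r y * exponentialPDF r (u + y)
      = ENNReal.ofReal (r / 2 * exp (-(r * |u|))) := by
  set m := max 0 (-u) with hm
  have hcongr : (fun y ↦ exponentialPDF r y * exponentialPDF r (u + y))
      = (Ici m).indicator
          fun y ↦ ENNReal.ofReal (r ^ 2 * exp (-(r * u)) * exp (-(2 * r) * y)) := by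
    funext y
    by_cases hy : m ≤ y
    · have h0 : 0 ≤ y := (le_max_left _ _).trans hy
      have h1 : 0 ≤ u + y := by linarith [(le_max_right 0 (-u)).trans hy]
      rw [indicator_of_mem (mem_Ici.2 hy), exponentialPDF_of_nonneg h0,
        exponentialPDF_of_nonneg h1, ← ENNReal.ofReal_mul (by positivity)]
      congr 1
      rw [mul_mul_mul_comm, ← sq, mul_assoc (r ^ 2), ← exp_add, ← exp_add]
      ring_nf
    · rw [indicator_of_notMem (by simpa using hy)]
      rcases lt_max_iff.1 (not_le.1 hy) with h | h
      · rw [exponentialPDF_of_neg h, zero_mul]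
      · rw [exponentialPDF_of_neg (by linarith : u + y < 0), mul_zero]
  have h2r : -(2 * r) < 0 := by linarith
  rw [hcongr, lintegral_indicator measurableSet_Ici,
    ← ofReal_integral_eq_lintegral_ofReal _ (ae_of_all _ fun y ↦ by positivity)]
  · rw [integral_Ici_eq_integral_Ioi, integral_const_mul, integral_exp_mul_Ioi h2r]
    congr 1
    have : exp (-(r * |u|)) = exp (-(r * u)) * exp (-(2 * r) * m) := by
      rw [← exp_add]
      congr 1
      rcases le_total 0 u with h | h
      · rw [hm, abs_of_nonneg h, max_eq_left (by linarith)]; ring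
      · rw [hm, abs_of_nonpos h, max_eq_right (by linarith)]; ring
    rw [this]
    field_simp
  · rw [← IntegrableOn, integrableOn_Ici_iff_integrableOn_Ioi]
    exact (integrableOn_exp_mul_Ioi h2r m).const_mul _

lemma map_sub_expMeasure {r : ℝ} (hr : 0 < r) :
    ((expMeasure r).prod (expMeasure r)).map (fun p ↦ p.1 - p.2) = laplaceMeasure r := by
  have := isProbabilityMeasure_expMeasure hr
  have hsub : Measurable fun p : ℝ × ℝ ↦ p.1 - p.2 := by fun_prop
  have hp := measurable_exponentialPDF r
  ext s hs
  rw [Measure.map_apply hsub hs, laplaceMeasure, withDensity_apply _ hs,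
    Measure.prod_apply_symm (hsub hs), expMeasure_eq_withDensity,
    lintegral_withDensity_eq_lintegral_mul_non_measurable _ hp
      (ae_of_all _ fun x ↦ ENNReal.ofReal_lt_top)]
  have hinner (y : ℝ) :
      volume.withDensity (exponentialPDF r) ((fun x ↦ (x, y)) ⁻¹' ((fun p ↦ p.1 - p.2) ⁻¹' s))
        = ∫⁻ u, exponentialPDF r (u + y) * s.indicator 1 u := by
    have hs' : MeasurableSet {x | x - y ∈ s} := (measurable_sub_const y) hs
    have : ((fun x : ℝ ↦ (x, y)) ⁻¹' ((fun p ↦ p.1 - p.2) ⁻¹' s)) = {x | x - y ∈ s} := rfl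
    rw [this, withDensity_apply _ hs', ← lintegral_indicator hs',
      ← lintegral_add_right_eq_self _ y]
    refine lintegral_congr fun u ↦ ?_
    by_cases hu : u ∈ s
    · simp [indicator, hu]
    · simp [indicator, hu]
  simp only [Pi.mul_apply, hinner]
  have hconst (a : ℝ) : exponentialPDF r a * ∫⁻ u, exponentialPDF r (u + a) * s.indicator 1 u
      = ∫⁻ u, exponentialPDF r a * (exponentialPDF r (u + a) * s.indicator 1 u) :=
    (lintegral_const_mul' _ _ ENNReal.ofReal_ne_top).symm
  simp only [hconst]
  rw [lintegral_lintegral_swap (by fun_prop), ← lintegral_indicator hs]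
  refine lintegral_congr fun u ↦ ?_
  simp_rw [← mul_assoc]
  rw [lintegral_mul_const _ (by fun_prop), lintegral_exponentialPDF_mul_shift hr]
  by_cases hu : u ∈ s <;> simp [hu]

lemma isProbabilityMeasure_laplaceMeasure {r : ℝ} (hr : 0 < r) :
    IsProbabilityMeasure (laplaceMeasure r) := by
  have := isProbabilityMeasure_expMeasure hr
  rw [← map_sub_expMeasure hr]
  exact Measure.isProbabilityMeasure_map (by fun_prop)

lemma laplaceMeasure_real_Ioi {r : ℝ} (hr : 0 < r) (c : ℝ) :
    (laplaceMeasure r).real (Ioi c) = laplaceTail r c := by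
  have := isProbabilityMeasure_laplaceMeasure hr
  have hreal {s : Set ℝ} (hs : MeasurableSet s) :
      (laplaceMeasure r).real s = ∫ u in s, r / 2 * exp (-(r * |u|)) := by
    rw [measureReal_def, laplaceMeasure, withDensity_apply _ hs,
      integral_eq_lintegral_of_nonneg_ae (ae_of_all _ fun u ↦ by positivity) (by fun_prop)]
  rw [laplaceTail]
  split_ifs with h
  · rw [hreal measurableSet_Ioi, setIntegral_congr_fun (g := fun u ↦ r / 2 * exp (-r * u))
      measurableSet_Ioi, integral_const_mul, integral_exp_mul_Ioi (by linarith)]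
    · rw [neg_mul]; field_simp
    · intro u hu
      simp only [abs_of_nonneg (h.trans (mem_Ioi.1 hu).le), neg_mul]
  · rw [← compl_Iic, probReal_compl_eq_one_sub measurableSet_Iic, hreal measurableSet_Iic,
      setIntegral_congr_fun (g := fun u ↦ r / 2 * exp (r * u))
      measurableSet_Iic, integral_const_mul, integral_exp_mul_Iic hr]
    · field_simp
    · intro u hu
      have : u ≤ 0 := (mem_Iic.1 hu).trans (not_le.1 h).le
      simp only [abs_of_nonpos this, mul_neg, neg_neg]

lemma integral_laplaceMeasure {r : ℝ} (hr : 0 < r) (g : ℝ → ℝ) :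
    ∫ u, g u ∂laplaceMeasure r = ∫ u, r / 2 * exp (-(r * |u|)) * g u := by
  rw [laplaceMeasure, integral_withDensity_eq_integral_toReal_smul (by fun_prop)
    (ae_of_all _ fun x ↦ ENNReal.ofReal_lt_top)]
  refine integral_congr_ae (ae_of_all _ fun u ↦ ?_)
  simp only [smul_eq_mul]
  rw [ENNReal.toReal_ofReal (by positivity)]

lemma integral_expMeasure (r : ℝ) (hr : 0 < r) (g : ℝ → ℝ) :
    ∫ u, g u ∂expMeasure r = ∫ u in Ioi 0, r * exp (-(r * u)) * g u := by
  rw [expMeasure_eq_withDensity, integral_withDensity_eq_integral_toReal_smul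
    (measurable_exponentialPDF r) (ae_of_all _ fun x ↦ ENNReal.ofReal_lt_top),
    ← integral_Ici_eq_integral_Ioi, ← integral_indicator measurableSet_Ici]
  refine integral_congr_ae (ae_of_all _ fun u ↦ ?_)
  by_cases hu : 0 ≤ u
  · simp only [smul_eq_mul, indicator_of_mem (mem_Ici.2 hu), exponentialPDF_of_nonneg hu]
    rw [ENNReal.toReal_ofReal (by positivity)]
  · simp [hu, exponentialPDF_of_neg (not_le.1 hu)]

lemma expMeasure_prod_real_lt_sub {r : ℝ} (hr : 0 < r) (c : ℝ) :
    ((expMeasure r).prod (expMeasure r)).real {p | c < p.1 - p.2} = laplaceTail r c := by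
  rw [← laplaceMeasure_real_Ioi hr, ← map_sub_expMeasure hr,
    map_measureReal_apply (by fun_prop) measurableSet_Ioi]
  rfl

lemma laplaceTail_nonneg {r : ℝ} (hr : 0 < r) (c : ℝ) : 0 ≤ laplaceTail r c := by
  rw [← laplaceMeasure_real_Ioi hr]
  exact measureReal_nonneg

lemma laplaceTail_le_one {r : ℝ} (hr : 0 < r) (c : ℝ) : laplaceTail r c ≤ 1 := by
  have := isProbabilityMeasure_laplaceMeasure hr
  rw [← laplaceMeasure_real_Ioi hr]
  exact measureReal_le_one

@[fun_prop]
lemma measurable_laplaceTail (r : ℝ) : Measurable (laplaceTail r) :=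
  Measurable.ite measurableSet_Ici (by fun_prop) (by fun_prop)

lemma laplaceTail_neg (r c : ℝ) : laplaceTail r (-c) = 1 - laplaceTail r c := by
  rcases lt_trichotomy c 0 with h | rfl | h
  · simp [laplaceTail, h.le, h.not_ge]
  · simp [laplaceTail]; norm_num
  · simp [laplaceTail, h.le, h]

lemma laplaceTail_div (r ν c : ℝ) (hν : 0 < ν) :
    laplaceTail r (c / ν) = laplaceTail (r / ν) c := by
  simp only [laplaceTail, le_div_iff₀ hν, zero_mul]
  rw [show r * (c / ν) = r / ν * c by ring]

lemma mul_laplaceTail_neg (r ν u : ℝ) (hν : 0 < ν) :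
    u * laplaceTail r (-(ν * u)) = u / 2 + |u| * (1 - exp (-(r * ν * |u|))) / 2 := by
  rw [laplaceTail_neg]
  rcases le_or_gt 0 u with h | h
  · rw [laplaceTail, if_pos (by positivity), abs_of_nonneg h, ← mul_assoc]
    ring
  · rw [laplaceTail, if_neg (not_le.2 (mul_neg_of_pos_of_neg hν h)), abs_of_neg h,
      mul_neg, neg_neg, ← mul_assoc]
    ring

lemma integral_Ioi_mul_exp_neg {c : ℝ} (hc : 0 < c) :
    ∫ u in Ioi (0 : ℝ), u * exp (-(c * u)) = 1 / c ^ 2 := by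
  have := Real.integral_rpow_mul_exp_neg_mul_Ioi (a := 2) two_pos hc
  rw [Real.Gamma_two, mul_one, Real.rpow_two, one_div_pow] at this
  rw [← this]
  refine setIntegral_congr_fun measurableSet_Ioi fun u _ ↦ ?_
  norm_num

lemma integrableOn_Ioi_mul_exp_neg {c : ℝ} (hc : 0 < c) :
    IntegrableOn (fun u : ℝ ↦ u * exp (-(c * u))) (Ioi 0) :=
  Integrable.of_integral_ne_zero (by rw [integral_Ioi_mul_exp_neg hc]; positivity)

lemma integral_id_expMeasure {r : ℝ} (hr : 0 < r) : ∫ u, u ∂expMeasure r = 1 / r := by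
  rw [integral_expMeasure r hr]
  simp_rw [mul_assoc, mul_comm (exp _)]
  rw [integral_const_mul, integral_Ioi_mul_exp_neg hr]
  field_simp

lemma integrable_id_expMeasure {r : ℝ} (hr : 0 < r) :
    Integrable (fun u : ℝ ↦ u) (expMeasure r) :=
  Integrable.of_integral_ne_zero (by rw [integral_id_expMeasure hr]; positivity)

lemma integral_laplaceMeasure_abs_mul {r s : ℝ} (hr : 0 < r) (hs : 0 < s) :
    ∫ u, |u| * (1 - exp (-(s * |u|))) / 2 ∂laplaceMeasure r
      = r / 2 * (1 / r ^ 2 - 1 / (r + s) ^ 2) := by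
  rw [integral_laplaceMeasure hr,
    integral_comp_abs (f := fun u ↦ r / 2 * exp (-(r * u)) * (u * (1 - exp (-(s * u))) / 2)),
    ← integral_Ioi_mul_exp_neg hr, ← integral_Ioi_mul_exp_neg (add_pos hr hs),
    ← integral_sub (integrableOn_Ioi_mul_exp_neg hr)
      (integrableOn_Ioi_mul_exp_neg (add_pos hr hs)), ← integral_const_mul, ← integral_const_mul]
  refine setIntegral_congr_fun measurableSet_Ioi fun u _ ↦ ?_
  simp only [add_mul, neg_add, exp_add]
  ring

lemma integral_selected_energy {a r ν : ℝ} (ha : 0 < a) (hr : 0 < r) (hν : 0 < ν) :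
    ∫ e, (e.2 + (e.1 - e.2) * laplaceTail a (ν * (e.2 - e.1)))
        ∂((expMeasure r).prod (expMeasure r))
      = 1 / r + r / 2 * (1 / r ^ 2 - 1 / (r + a * ν) ^ 2) := by
  have := isProbabilityMeasure_expMeasure hr
  have h1 : Integrable (fun e : ℝ × ℝ ↦ e.1) ((expMeasure r).prod (expMeasure r)) :=
    (integrable_id_expMeasure hr).comp_fst _
  have h2 : Integrable (fun e : ℝ × ℝ ↦ e.2) ((expMeasure r).prod (expMeasure r)) :=
    (integrable_id_expMeasure hr).comp_snd _
  have h12 : Integrable (fun e : ℝ × ℝ ↦ (e.1 + e.2) / 2) ((expMeasure r).prod (expMeasure r)) :=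
    (h1.add h2).div_const 2
  have hrw (e : ℝ × ℝ) : e.2 + (e.1 - e.2) * laplaceTail a (ν * (e.2 - e.1))
      = (e.1 + e.2) / 2
        + |e.1 - e.2| * (1 - exp (-(a * ν * |e.1 - e.2|))) / 2 := by
    rw [show ν * (e.2 - e.1) = -(ν * (e.1 - e.2)) by ring, mul_laplaceTail_neg _ _ _ hν]
    ring
  simp_rw [hrw]
  rw [integral_add h12, integral_div, integral_add h1 h2,
    integral_fun_fst (fun x : ℝ ↦ x), integral_fun_snd (fun x : ℝ ↦ x),
    integral_id_expMeasure hr,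
    ← integral_laplaceMeasure_abs_mul hr (mul_pos ha hν), ← map_sub_expMeasure hr, integral_map]
  · simp
  · fun_prop
  · exact Measurable.aestronglyMeasurable (by fun_prop)
  · refine ((h1.sub h2).abs.mono' (Measurable.aestronglyMeasurable (by fun_prop))
      (ae_of_all _ fun e ↦ ?_))
    have hexp : exp (-(a * ν * |e.1 - e.2|)) ≤ 1 := exp_le_one_iff.2 (by
      have := abs_nonneg (e.1 - e.2)
      have := mul_pos ha hν
      simp only [Left.neg_nonpos_iff]
      positivity)
    have hpos := exp_pos (-(a * ν * |e.1 - e.2|))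
    rw [Real.norm_of_nonneg (div_nonneg (mul_nonneg (abs_nonneg _) (by linarith)) two_pos.le)]
    simp only [Pi.sub_apply]
    nlinarith [abs_nonneg (e.1 - e.2)]

lemma measurePreserving_prodAssoc_wdMeasure {γbar εbar : ℝ} (hγ : 0 < γbar) (hε : 0 < εbar) :
    MeasurePreserving (MeasurableEquiv.prodAssoc : (ℝ × ℝ) × ℝ × ℝ ≃ᵐ ℝ × ℝ × ℝ × ℝ)
      (((expMeasure (2 / γbar)).prod (expMeasure (2 / γbar))).prod
        ((expMeasure (1 / εbar)).prod (expMeasure (1 / εbar)))) (wdMeasure γbar εbar) := by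
  have := isProbabilityMeasure_expMeasure (div_pos two_pos hγ)
  have := isProbabilityMeasure_expMeasure (one_div_pos.2 hε)
  exact measurePreserving_prodAssoc _ _ _

lemma measurableSet_selects_fst (ν : ℝ) :
    MeasurableSet {q : (ℝ × ℝ) × ℝ × ℝ | ν * (q.2.2 - q.2.1) < q.1.1 - q.1.2} :=
  measurableSet_lt (by fun_prop) (by fun_prop)

lemma integral_prod_selected_energy {a r ν : ℝ} (ha : 0 < a) (hr : 0 < r) (hν : 0 < ν) :
    ∫ q : (ℝ × ℝ) × ℝ × ℝ,
        (if ν * (q.2.2 - q.2.1) < q.1.1 - q.1.2 then q.2.1 else q.2.2)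
        ∂(((expMeasure a).prod (expMeasure a)).prod ((expMeasure r).prod (expMeasure r)))
      = 1 / r + r / 2 * (1 / r ^ 2 - 1 / (r + a * ν) ^ 2) := by
  have := isProbabilityMeasure_expMeasure ha
  have := isProbabilityMeasure_expMeasure hr
  rw [integral_prod_symm]
  · rw [← integral_selected_energy ha hr hν]
    refine integral_congr_ae (ae_of_all _ fun e ↦ ?_)
    have hs : MeasurableSet {p : ℝ × ℝ | ν * (e.2 - e.1) < p.1 - p.2} :=
      measurableSet_lt (by fun_prop) (by fun_prop)
    have hite (p : ℝ × ℝ) : (if ν * (e.2 - e.1) < p.1 - p.2 then e.1 else e.2)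
        = e.2 + {p : ℝ × ℝ | ν * (e.2 - e.1) < p.1 - p.2}.indicator
            (fun _ ↦ e.1 - e.2) p := by
      by_cases h : ν * (e.2 - e.1) < p.1 - p.2 <;> simp [h]
    simp only [hite]
    rw [integral_add (integrable_const _) ((integrable_const _).indicator hs), integral_const,
      integral_indicator_const _ hs, expMeasure_prod_real_lt_sub ha]
    simp [mul_comm]
  · have h1 : Integrable (fun e : ℝ × ℝ ↦ e.1) ((expMeasure r).prod (expMeasure r)) :=
      (integrable_id_expMeasure hr).comp_fst _
    have h2 : Integrable (fun e : ℝ × ℝ ↦ e.2) ((expMeasure r).prod (expMeasure r)) :=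
      (integrable_id_expMeasure hr).comp_snd _
    have h1' := (h1.comp_snd ((expMeasure a).prod (expMeasure a))).abs
    have h2' := (h2.comp_snd ((expMeasure a).prod (expMeasure a))).abs
    refine (h1'.add h2').mono' (Measurable.ite (measurableSet_selects_fst ν) (by fun_prop)
      (by fun_prop)).aestronglyMeasurable (ae_of_all _ fun q ↦ ?_)
    simp only [Pi.add_apply, Real.norm_eq_abs]
    split_ifs <;> linarith [abs_nonneg q.2.1, abs_nonneg q.2.2]

/-- The probability that a threshold `x` exceeds an exponential variable of rate `a` perturbed by
an independent Laplace variable of rate `b`. -/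
lemma integral_laplaceTail_sub {a b x : ℝ} (ha : 0 < a) (hb : 0 < b) (hab : a ≠ b)
    (hx : 0 ≤ x) :
    ∫ y, laplaceTail b (y - x) ∂expMeasure a
      = 1 - exp (-(a * x)) - a / (b - a) * (exp (-(a * x)) - exp (-(b * x))) / 2
        + a / (a + b) * exp (-(a * x)) / 2 := by
  have hba : b - a ≠ 0 := sub_ne_zero.2 hab.symm
  set f : ℝ → ℝ := fun y ↦ a * exp (-(a * y)) * laplaceTail b (y - x) with hf
  have hfi : IntegrableOn f (Ioi 0) := by
    have : IntegrableOn (fun y ↦ a * exp (-(a * y))) (Ioi 0) := by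
      have h := (integrableOn_exp_mul_Ioi (neg_lt_zero.2 ha) 0).const_mul a
      simp only [neg_mul] at h
      exact h
    refine Integrable.mul_bdd (c := 1) this (Measurable.aestronglyMeasurable (by fun_prop))
      (ae_of_all _ fun y ↦ ?_)
    rw [Real.norm_of_nonneg (laplaceTail_nonneg hb _)]
    exact laplaceTail_le_one hb _
  rw [integral_expMeasure a ha,
    ← intervalIntegral.integral_interval_add_Ioi hfi (hfi.mono_set (Ioi_subset_Ioi hx))]
  have hleft : ∫ y in (0 : ℝ)..x, f y
      = 1 - exp (-(a * x)) - a / (b - a) * (exp (-(a * x)) - exp (-(b * x))) / 2 := by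
    have hderiv (y : ℝ) : HasDerivAt
        (fun y ↦ -exp (-(a * y)) - a / (b - a) * exp ((b - a) * y - b * x) / 2)
        (a * exp (-(a * y)) - a * exp ((b - a) * y - b * x) / 2) y := by
      have h := ((((hasDerivAt_id y).const_mul (b - a)).sub_const (b * x)).exp.const_mul
        (a / (b - a))).div_const 2
      convert! hasDerivAt_neg_exp_mul_exp.sub h using 1
      simp only [id_eq]
      field_simp
    rw [intervalIntegral.integral_congr
      (g := fun y ↦ a * exp (-(a * y)) - a * exp ((b - a) * y - b * x) / 2),
      intervalIntegral.integral_eq_sub_of_hasDerivAt (fun y _ ↦ hderiv y)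
        (Continuous.intervalIntegrable (by fun_prop) _ _)]
    · rw [show (b - a) * x - b * x = -(a * x) by ring]
      simp
      ring
    · intro y hy
      rw [uIcc_of_le hx] at hy
      have hexp : exp ((b - a) * y - b * x) = exp (-(a * y)) * exp (b * (y - x)) := by
        rw [← exp_add]; ring_nf
      simp only [hf, laplaceTail, hexp]
      rcases hy.2.eq_or_lt with h | h
      · simp [h]; ring
      · rw [if_neg (by linarith)]; ring
  have hright : ∫ y in Ioi x, f y = a / (a + b) * exp (-(a * x)) / 2 := by
    rw [setIntegral_congr_fun (g := fun y ↦ a / 2 * exp (b * x) * exp (-(a + b) * y))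
      measurableSet_Ioi, integral_const_mul, integral_exp_mul_Ioi (by linarith)]
    · have : exp (-(a * x)) = exp (b * x) * exp (-(a + b) * x) := by
        rw [← exp_add]; ring_nf
      rw [this]
      field_simp
    · intro y hy
      have hexp : exp (b * x) * exp (-(a + b) * y) = exp (-(a * y)) * exp (-(b * (y - x))) := by
        rw [← exp_add, ← exp_add]; ring_nf
      simp only [hf, laplaceTail, if_pos (sub_nonneg.2 (mem_Ioi.1 hy).le), mul_assoc, hexp]
      ring
  rw [hleft, hright]

lemma setIntegral_integral_laplaceTail_sub {a b t : ℝ} (ha : 0 < a) (hb : 0 < b) (hab : a ≠ b)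
    (ht : 0 ≤ t) :
    ∫ x, (Iio t).indicator (fun x ↦ ∫ y, laplaceTail b (y - x) ∂expMeasure a) x ∂expMeasure a
      = (1 - exp (-(a * t)))
        - (1 + a / (b - a) / 2 - a / (a + b) / 2) * (1 - exp (-(2 * a * t))) / 2
        + a / (b - a) / 2 * (a / (a + b)) * (1 - exp (-((a + b) * t))) := by
  have hba : b - a ≠ 0 := sub_ne_zero.2 hab.symm
  have hderiv (x : ℝ) : HasDerivAt
      (fun x ↦ -exp (-(a * x))
        + (1 + a / (b - a) / 2 - a / (a + b) / 2) / 2 * exp (-(2 * a * x))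
        - a / (b - a) / 2 * (a / (a + b)) * exp (-((a + b) * x)))
      (a * exp (-(a * x)) * (1 - exp (-(a * x))
        - a / (b - a) * (exp (-(a * x)) - exp (-(b * x))) / 2
        + a / (a + b) * exp (-(a * x)) / 2)) x := by
    have h2 := (((hasDerivAt_id x).const_mul (2 * a)).neg.exp.const_mul
      ((1 + a / (b - a) / 2 - a / (a + b) / 2) / 2))
    have h3 := (((hasDerivAt_id x).const_mul (a + b)).neg.exp.const_mul
      (a / (b - a) / 2 * (a / (a + b))))
    convert! (hasDerivAt_neg_exp_mul_exp.add h2).sub h3 using 1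
    have e2 : exp (-(2 * a * x)) = exp (-(a * x)) * exp (-(a * x)) := by
      rw [← exp_add]; ring_nf
    have e3 : exp (-((a + b) * x)) = exp (-(a * x)) * exp (-(b * x)) := by
      rw [← exp_add]; ring_nf
    simp only [id_eq, Pi.neg_apply, e2, e3]
    field_simp
    ring
  have hcongr : EqOn (fun x ↦ a * exp (-(a * x)) * ∫ y, laplaceTail b (y - x) ∂expMeasure a)
      (fun x ↦ a * exp (-(a * x)) * (1 - exp (-(a * x))
        - a / (b - a) * (exp (-(a * x)) - exp (-(b * x))) / 2
        + a / (a + b) * exp (-(a * x)) / 2)) (uIcc 0 t) := by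
    intro x hx
    rw [uIcc_of_le ht] at hx
    exact congrArg _ (integral_laplaceTail_sub ha hb hab hx.1)
  rw [integral_expMeasure a ha]
  have hind (x : ℝ) : a * exp (-(a * x))
        * (Iio t).indicator (fun x ↦ ∫ y, laplaceTail b (y - x) ∂expMeasure a) x
      = (Iio t).indicator
          (fun x ↦ a * exp (-(a * x)) * ∫ y, laplaceTail b (y - x) ∂expMeasure a) x := by
    by_cases h : x < t <;> simp [h]
  simp_rw [hind]
  rw [setIntegral_indicator measurableSet_Iio, Ioi_inter_Iio, ← integral_Ioc_eq_integral_Ioo,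
    ← intervalIntegral.integral_of_le ht, intervalIntegral.integral_congr hcongr,
    intervalIntegral.integral_eq_sub_of_hasDerivAt (fun x _ ↦ hderiv x)
      (Continuous.intervalIntegrable (by fun_prop) _ _)]
  simp
  ring

lemma outage_prod_real {a r ν t : ℝ} (ha : 0 < a) (hr : 0 < r) (hν : 0 < ν) :
    (((expMeasure a).prod (expMeasure a)).prod ((expMeasure r).prod (expMeasure r))).real
        {q | (if ν * (q.2.2 - q.2.1) < q.1.1 - q.1.2 then q.1.1 else q.1.2) < t}
      = 2 * ∫ x, (Iio t).indicator
          (fun x ↦ ∫ y, laplaceTail (r / ν) (y - x) ∂expMeasure a) x ∂expMeasure a := by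
  have := isProbabilityMeasure_expMeasure ha
  have := isProbabilityMeasure_expMeasure hr
  have hS : MeasurableSet {q : (ℝ × ℝ) × ℝ × ℝ |
      (if ν * (q.2.2 - q.2.1) < q.1.1 - q.1.2 then q.1.1 else q.1.2) < t} :=
    measurableSet_lt (Measurable.ite (measurableSet_selects_fst ν) (by fun_prop) (by fun_prop))
      measurable_const
  set F : ℝ × ℝ → ℝ := fun p ↦ (Iio t).indicator (fun _ ↦ laplaceTail (r / ν) (p.2 - p.1)) p.1
    with hF
  have hFm : Measurable F := by
    have : F = {p : ℝ × ℝ | p.1 < t}.indicator fun p ↦ laplaceTail (r / ν) (p.2 - p.1) := rfl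
    rw [this]
    exact Measurable.indicator (by fun_prop) (measurableSet_lt (by fun_prop) (by fun_prop))
  have hFi : Integrable F ((expMeasure a).prod (expMeasure a)) := by
    refine Integrable.of_bound hFm.aestronglyMeasurable 1 (ae_of_all _ fun p ↦ ?_)
    have h0 := laplaceTail_nonneg (div_pos hr hν) (p.2 - p.1)
    have h1 := laplaceTail_le_one (div_pos hr hν) (p.2 - p.1)
    by_cases h : p.1 < t <;> simp [hF, h, abs_of_nonneg, h0, h1]
  have hFint : ∫ p, F p ∂((expMeasure a).prod (expMeasure a)) = ∫ x, (Iio t).indicator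
      (fun x ↦ ∫ y, laplaceTail (r / ν) (y - x) ∂expMeasure a) x ∂expMeasure a := by
    rw [integral_prod _ hFi]
    refine integral_congr_ae (ae_of_all _ fun x ↦ ?_)
    by_cases h : x < t <;> simp [hF, h]
  rw [← integral_indicator_one hS, integral_prod _ ((integrable_const 1).indicator hS),
    ← hFint, two_mul]
  have hswap : ∫ p, F p ∂((expMeasure a).prod (expMeasure a))
      = ∫ p, (F ∘ Prod.swap) p ∂((expMeasure a).prod (expMeasure a)) := (integral_prod_swap F).symm
  nth_rewrite 2 [hswap]
  rw [← integral_add hFi hFi.swap]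
  refine integral_congr_ae (ae_of_all _ fun p ↦ ?_)
  have hs : MeasurableSet {e : ℝ × ℝ | (p.2 - p.1) / ν < e.1 - e.2} :=
    measurableSet_lt (by fun_prop) (by fun_prop)
  set s := {e : ℝ × ℝ | (p.2 - p.1) / ν < e.1 - e.2} with hs_def
  have hsel (e : ℝ × ℝ) : ν * (e.2 - e.1) < p.1 - p.2 ↔ e ∈ s := by
    rw [hs_def, mem_ofPred_eq, div_lt_iff₀ hν]
    constructor <;> intro h <;> linarith
  have hind (e : ℝ × ℝ) : {q : (ℝ × ℝ) × ℝ × ℝ |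
      (if ν * (q.2.2 - q.2.1) < q.1.1 - q.1.2 then q.1.1 else q.1.2) < t}.indicator
        (1 : (ℝ × ℝ) × ℝ × ℝ → ℝ) (p, e)
      = s.indicator (fun _ ↦ (Iio t).indicator 1 p.1) e
        + sᶜ.indicator (fun _ ↦ (Iio t).indicator 1 p.2) e := by
    simp only [indicator, mem_ofPred_eq, hsel, mem_compl_iff, mem_Iio]
    by_cases h : e ∈ s <;> simp [h]
  simp only [hind]
  rw [integral_add ((integrable_const _).indicator hs) ((integrable_const _).indicator hs.compl),
    integral_indicator_const _ hs, integral_indicator_const _ hs.compl,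
    probReal_compl_eq_one_sub hs, hs_def, expMeasure_prod_real_lt_sub hr, ← laplaceTail_neg,
    ← neg_div, neg_sub, laplaceTail_div _ _ _ hν, laplaceTail_div _ _ _ hν]
  by_cases h1 : p.1 < t <;> by_cases h2 : p.2 < t <;> simp [hF, h1, h2]

lemma outage_closed_form {a k t : ℝ} (ha : a ≠ 0) (hk : 0 < k) (hk1 : k ≠ 1) :
    2 * ((1 - exp (-(a * t)))
        - (1 + a / (a / k - a) / 2 - a / (a + a / k) / 2) * (1 - exp (-(2 * a * t))) / 2
        + a / (a / k - a) / 2 * (a / (a + a / k)) * (1 - exp (-((a + a / k) * t))))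
      = (exp (-(2 * a * t)) * (exp (a * t) - 1) ^ 2
          + k ^ 2 * (exp (-(a * t)) * (2 - exp (-(a * t / k))) - 1)) / (1 - k ^ 2) := by
  have h1 : 1 - k ≠ 0 := sub_ne_zero.2 hk1.symm
  have h2 : 1 + k ≠ 0 := by positivity
  have c1 : a / (a / k - a) = k / (1 - k) := by
    have : a / k - a = a * ((1 - k) / k) := by field_simp
    rw [this]; field_simp
  have c2 : a / (a + a / k) = k / (1 + k) := by
    have : a + a / k = a * ((1 + k) / k) := by field_simp; ring
    rw [this]; field_simp
  have e1 : exp (-(2 * a * t)) = exp (-(a * t)) ^ 2 := by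
    rw [sq, ← exp_add]; ring_nf
  have e2 : exp (-((a + a / k) * t)) = exp (-(a * t)) * exp (-(a * t / k)) := by
    rw [← exp_add]; ring_nf
  have e3 : exp (-(a * t)) * exp (a * t) = 1 := by rw [← exp_add]; simp
  have e4 : exp (-(a * t)) ^ 2 * (exp (a * t) - 1) ^ 2 = (1 - exp (-(a * t))) ^ 2 := by
    rw [← mul_pow, mul_sub, e3, mul_one]
  rw [c1, c2, e1, e2, e4, show 1 - k ^ 2 = (1 - k) * (1 + k) by ring]
  field_simp
  ring


/-- Proposition 2: the outage probability of the weighted difference scheme for a given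
average energy transfer `ε`.  With `k = √(ε̄/(3ε̄-2ε)) - 1` and `ν = γ̄k/(2ε̄)`, the
scheme (select relay 1 iff `γ₁ - γ₂ > ν(ε₂ - ε₁)`) achieves average energy transfer `ε`
and the stated outage probability. -/
theorem weightedDifference_outage_tradeoff (γbar εbar γth ε : ℝ) (hγ : 0 < γbar)
    (hε : 0 < εbar) (hγth : 0 < γth) (hεrange : ε ∈ Set.Ioo εbar (3 / 2 * εbar))
    (k ν : ℝ) (hk : k = Real.sqrt (εbar / (3 * εbar - 2 * ε)) - 1) (hk1 : k ≠ 1)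
    (hν : ν = γbar * k / (2 * εbar)) :
    (∫ ω, (if ν * (ω.2.2.2 - ω.2.2.1) < ω.1 - ω.2.1 then ω.2.2.1 else ω.2.2.2)
        ∂(wdMeasure γbar εbar)) = ε
    ∧ wdMeasure γbar εbar
        {ω | (if ν * (ω.2.2.2 - ω.2.2.1) < ω.1 - ω.2.1 then ω.1 else ω.2.1) < γth}
      = ENNReal.ofReal
          ((Real.exp (-4 * γth / γbar) * (Real.exp (2 * γth / γbar) - 1) ^ 2
              + k ^ 2 *
                (Real.exp (-2 * γth / γbar) * (2 - Real.exp (-2 * γth / (γbar * k))) - 1))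
            / (1 - k ^ 2)) := by
  obtain ⟨hε1, hε2⟩ := hεrange
  have hden : 0 < 3 * εbar - 2 * ε := by linarith
  have hk0 : 0 < k := by
    rw [hk, sub_pos, Real.lt_sqrt zero_le_one, one_pow, one_lt_div hden]
    linarith
  have hksq : (1 + k) ^ 2 = εbar / (3 * εbar - 2 * ε) := by
    rw [hk, add_sub_cancel, Real.sq_sqrt (by positivity)]
  have hν0 : 0 < ν := by rw [hν]; positivity
  have ha : 0 < 2 / γbar := by positivity
  have hr : 0 < 1 / εbar := by positivity
  have hmp := measurePreserving_prodAssoc_wdMeasure hγ hε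
  have haν : 2 / γbar * ν = 1 / εbar * k := by rw [hν]; field_simp
  have hrν : 1 / εbar / ν = 2 / γbar / k := by rw [hν]; field_simp
  have := isProbabilityMeasure_expMeasure ha
  have := isProbabilityMeasure_expMeasure hr
  constructor
  · rw [← hmp.integral_comp']
    refine (integral_prod_selected_energy ha hr hν0).trans ?_
    have h1k : (1 + k) ≠ 0 := by positivity
    rw [haν, show 1 / εbar + 1 / εbar * k = 1 / εbar * (1 + k) by ring, mul_pow, hksq]
    field_simp
    ring
  · have hab : 2 / γbar ≠ 2 / γbar / k := by
      rw [ne_eq, eq_div_iff hk0.ne']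
      exact fun h ↦ hk1 ((mul_eq_left₀ ha.ne').1 h)
    have hreal := outage_prod_real (t := γth) ha hr hν0
    rw [hrν, setIntegral_integral_laplaceTail_sub ha (div_pos ha hk0) hab hγth.le,
      outage_closed_form ha.ne' hk0 hk1] at hreal
    rw [← hmp.measure_preimage_equiv, ← ENNReal.ofReal_toReal (measure_ne_top _ _)]
    refine congrArg ENNReal.ofReal (hreal.trans ?_)
    rw [show -(2 * (2 / γbar) * γth) = -4 * γth / γbar by ring,
      show 2 / γbar * γth = 2 * γth / γbar by ring,
      show -(2 * γth / γbar) = -2 * γth / γbar by ring,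
      show -(2 * γth / γbar / k) = -2 * γth / (γbar * k) by rw [div_div, ← neg_div, neg_mul]]
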